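/- arXiv:1807.04613 — 2 statements merged into one kernel-verified Lean document; each statement's English description precedes it below -/
import Mathlib

section
/- The Move-Half algorithm is 4 access-competitive to an MRU algorithm: for every request sequence σ, the total access cost of Move-Half on σ (the sum over t of the depth of σ^(t) in Move-Half's tree at time t) is at most 4 times the total access cost incurred on an MRU tree, namely 4·∑_{t=1}^m ⌊log₂(rank of σ^(t) at time t)⌋. -/
/-!
Model: `n` items (elements of `Fin n`) are stored, one per server, on the `n`
servers of a fixed complete binary tree.  Servers are indexed in heap order by
`Fin n` (server `s` has heap index `s + 1`); the root (index `0`) has depth `0`.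
A configuration is a bijection `Fin n ≃ Fin n` from items to servers; the depth
of an item is the depth of its hosting server.
-/

/-- Depth of the server with 0-based heap index `s` in the complete binary tree
(the root, index `0`, has depth `0`). -/
def sDepth {n : ℕ} (s : Fin n) : ℕ := Nat.log 2 (s.val + 1)

/-- The parent server of `s` in the complete binary tree (the root is its own parent). -/
def sParent {n : ℕ} (s : Fin n) : Fin n :=
  ⟨(s.val + 1) / 2 - 1, by
    have h := Nat.div_le_self (s.val + 1) 2
    have h2 := s.isLt
    omega⟩

/-- Apply a list of swaps to a configuration (a bijection from items to servers):
each swap exchanges the item at the given server with the item at its parent server,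
at unit cost per swap. -/
def applySwaps {n : ℕ} (l : List (Fin n)) (c : Fin n ≃ Fin n) : Fin n ≃ Fin n :=
  l.foldl (fun c s => c.trans (Equiv.swap s (sParent s))) c

/-- The rank of item `v` at time `t` (the number of distinct items requested since the
last request to `v` prior to `t`, including `v`): upon a request to an item its rank
becomes `1`, the ranks of items with smaller rank increase by one, and all other ranks
are unchanged.  Initially the ranks are induced by the bijection `r0`
(`itemRank r0 σ 0 v = r0 v + 1`, a permutation of `1, …, n`). -/
def itemRank {n : ℕ} (r0 : Fin n ≃ Fin n) (σ : ℕ → Fin n) : ℕ → Fin n → ℕ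
  | 0 => fun v => (r0 v).val + 1
  | t + 1 => fun v =>
      if v = σ t then 1
      else if itemRank r0 σ t v < itemRank r0 σ t (σ t) then itemRank r0 σ t v + 1
      else itemRank r0 σ t v

theorem itemRank_pos {n : ℕ} (r0 : Fin n ≃ Fin n) (σ : ℕ → Fin n) (t : ℕ) (v : Fin n) :
    1 ≤ itemRank r0 σ t v := by
  induction t with
  | zero => simp [itemRank]
  | succ t ih =>
    simp only [itemRank]
    split_ifs <;> omega

theorem itemRank_injective {n : ℕ} (r0 : Fin n ≃ Fin n) (σ : ℕ → Fin n) (t : ℕ) :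
    Function.Injective (itemRank r0 σ t) := by
  induction t with
  | zero =>
    intro a b h
    simp only [itemRank] at h
    exact r0.injective (Fin.ext (by omega))
  | succ t ih =>
    intro a b h
    have ha := itemRank_pos r0 σ t a
    have hb := itemRank_pos r0 σ t b
    have hσ := itemRank_pos r0 σ t (σ t)
    have ha' : a ≠ σ t → itemRank r0 σ t a ≠ itemRank r0 σ t (σ t) := mt (@ih a (σ t))
    have hb' : b ≠ σ t → itemRank r0 σ t b ≠ itemRank r0 σ t (σ t) := mt (@ih b (σ t))
    simp only [itemRank] at h
    by_cases hat : a = σ t <;> by_cases hbt : b = σ t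
    · rw [hat, hbt]
    · have := hb' hbt
      rw [if_pos hat, if_neg hbt] at h
      split_ifs at h <;> omega
    · have := ha' hat
      rw [if_neg hat, if_pos hbt] at h
      split_ifs at h <;> omega
    · have := ha' hat
      have := hb' hbt
      rw [if_neg hat, if_neg hbt] at h
      apply ih
      split_ifs at h <;> omega

theorem itemRank_le_succ {n : ℕ} (r0 : Fin n ≃ Fin n) (σ : ℕ → Fin n) (t : ℕ) {v : Fin n}
    (hv : v ≠ σ t) : itemRank r0 σ t v ≤ itemRank r0 σ (t + 1) v := by
  simp only [itemRank, if_neg hv]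
  split_ifs <;> omega

theorem two_le_itemRank_succ {n : ℕ} (r0 : Fin n ≃ Fin n) (σ : ℕ → Fin n) (t : ℕ) {v : Fin n}
    (hv : v ≠ σ t) : 2 ≤ itemRank r0 σ (t + 1) v := by
  have h1 := itemRank_pos r0 σ t v
  have h2 := itemRank_pos r0 σ t (σ t)
  have h3 : itemRank r0 σ t v ≠ itemRank r0 σ t (σ t) := fun h => hv (itemRank_injective r0 σ t h)
  simp only [itemRank, if_neg hv]
  split_ifs <;> omega

/-- The level `k` at half the depth of some server is full, so any upper bound for the values of an
injective positive labelling on the items of that level is at least `2 ^ k`. -/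
theorem two_pow_le_of_forall_depth_le {n : ℕ} (c : Fin n ≃ Fin n) (r : Fin n → ℕ)
    (hr : Function.Injective r) (hpos : ∀ x, 1 ≤ r x) (s : Fin n) (k b : ℕ)
    (hk : k = sDepth s / 2) (hb : ∀ x, sDepth (c x) = k → r x ≤ b) : 2 ^ k ≤ b := by
  have hs : 2 ^ sDepth s ≤ s.val + 1 := Nat.pow_log_le_self 2 (by omega)
  have hlt : ∀ i : Fin (2 ^ k), 2 ^ k - 1 + i.val < n := by
    intro i
    have hi := i.isLt
    have hsn := s.isLt
    rcases Nat.eq_zero_or_pos (sDepth s) with h0 | h0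
    · have : 2 ^ k = 1 := by simp [hk, h0]
      omega
    · have : 2 ^ (k + 1) ≤ 2 ^ sDepth s := Nat.pow_le_pow_right (by norm_num) (by omega)
      rw [pow_succ] at this
      omega
  have hdepth : ∀ i : Fin (2 ^ k), sDepth (⟨2 ^ k - 1 + i.val, hlt i⟩ : Fin n) = k := by
    intro i
    have hi := i.isLt
    have hp : 0 < 2 ^ k := by positivity
    refine Nat.log_eq_of_pow_le_of_lt_pow ?_ ?_
    · change 2 ^ k ≤ 2 ^ k - 1 + i.val + 1
      omega
    · change 2 ^ k - 1 + i.val + 1 < 2 ^ (k + 1)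
      rw [pow_succ]
      omega
  let item : Fin (2 ^ k) → Fin n := fun i => c.symm ⟨2 ^ k - 1 + i.val, hlt i⟩
  have hitem : ∀ i, r (item i) ≤ b := fun i => hb _ (by simp [item, hdepth])
  let f : Fin (2 ^ k) → Fin b := fun i =>
    ⟨r (item i) - 1, by have := hpos (item i); have := hitem i; omega⟩
  have hf : Function.Injective f := by
    intro i j hij
    have h1 : r (item i) - 1 = r (item j) - 1 := congrArg Fin.val hij
    have h2 := hpos (item i)
    have h3 := hpos (item j)
    have h4 : item i = item j := hr (by omega)
    have h5 := congrArg Fin.val (c.symm.injective h4)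
    simp only at h5
    exact Fin.ext (by omega)
  simpa using Fintype.card_le_of_injective f hf

/-- An upper bound on the cost `d + ⌊d/2⌋ + ⌊d/4⌋ + ⋯` of repeatedly requesting an item that
starts at depth `d`. -/
def halvingCost (d : ℕ) : ℕ := if d ≤ 1 then d else 2 * d - 1 - d % 2

theorem add_halvingCost_half_le (d : ℕ) : d + halvingCost (d / 2) ≤ halvingCost d := by
  unfold halvingCost
  split_ifs <;> omega

theorem halvingCost_le_four_mul {d l : ℕ} (h1 : d / 2 ≤ l) (h2 : 1 ≤ l) :
    halvingCost d ≤ 4 * l := by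
  unfold halvingCost
  split_ifs <;> omega

/-- The potential of an item at depth `d` with rank `r`. -/
def itemPotential (d r : ℕ) : ℕ := halvingCost d - 4 * Nat.log 2 r

/-- One Move-Half step: the access cost plus the increase of the total potential is at most four
times the access cost in the MRU tree. -/
theorem sum_itemPotential_succ_add_depth_le {n : ℕ} (r0 : Fin n ≃ Fin n) (σ : ℕ → Fin n)
    (c c' : Fin n ≃ Fin n) (t : ℕ) (v : Fin n)
    (hv : sDepth (c v) = sDepth (c (σ t)) / 2)
    (hmax : ∀ x : Fin n, sDepth (c x) = sDepth (c (σ t)) / 2 →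
      itemRank r0 σ t x ≤ itemRank r0 σ t v)
    (hc : c' = c.trans (Equiv.swap (c (σ t)) (c v))) :
    ∑ x, itemPotential (sDepth (c' x)) (itemRank r0 σ (t + 1) x) + sDepth (c (σ t))
      ≤ ∑ x, itemPotential (sDepth (c x)) (itemRank r0 σ t x)
        + 4 * Nat.log 2 (itemRank r0 σ t (σ t)) := by
  have hrequested :
      itemPotential (sDepth (c' (σ t))) (itemRank r0 σ (t + 1) (σ t)) + sDepth (c (σ t))
        ≤ itemPotential (sDepth (c (σ t))) (itemRank r0 σ t (σ t))
          + 4 * Nat.log 2 (itemRank r0 σ t (σ t)) := by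
    have hd : sDepth (c' (σ t)) = sDepth (c (σ t)) / 2 := by simp [hc, hv]
    have := add_halvingCost_half_le (sDepth (c (σ t)))
    rw [hd]
    simp only [itemPotential]
    omega
  have hother : ∀ x ∈ Finset.univ.erase (σ t),
      itemPotential (sDepth (c' x)) (itemRank r0 σ (t + 1) x)
        ≤ itemPotential (sDepth (c x)) (itemRank r0 σ t x) := by
    intro x hx
    have hx : x ≠ σ t := Finset.ne_of_mem_erase hx
    have hle := itemRank_le_succ r0 σ t hx
    by_cases hxv : x = v
    · subst hxv
      have hd : sDepth (c' x) = sDepth (c (σ t)) := by simp [hc]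
      have hpow := two_pow_le_of_forall_depth_le c (itemRank r0 σ t) (itemRank_injective r0 σ t)
        (itemRank_pos r0 σ t) (c (σ t)) _ _ rfl hmax
      have hcost := halvingCost_le_four_mul
        (Nat.le_log_of_pow_le one_lt_two (hpow.trans hle))
        (Nat.le_log_of_pow_le one_lt_two
          ((pow_one 2).le.trans (two_le_itemRank_succ r0 σ t hx)))
      rw [hd, itemPotential, Nat.sub_eq_zero_of_le hcost]
      exact Nat.zero_le _
    · have hd : c' x = c x := by
        rw [hc, Equiv.trans_apply]
        exact Equiv.swap_apply_of_ne_of_ne (c.injective.ne hx) (c.injective.ne hxv)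
      have := Nat.log_mono_right (b := 2) hle
      rw [hd]
      simp only [itemPotential]
      omega
  have hsum := Finset.sum_le_sum hother
  rw [← Finset.add_sum_erase _ _ (Finset.mem_univ (σ t)),
    ← Finset.add_sum_erase _ (fun x => itemPotential (sDepth (c x)) (itemRank r0 σ t x))
      (Finset.mem_univ (σ t))]
  omega

/-- The Move-Half algorithm — which serves a request to the item `σ t`, currently at depth
`d`, by interchanging its position with the item `v` of highest rank at depth `⌊d/2⌋` —
is `4` access-competitive to an MRU algorithm: its total access cost
`∑_{t<m} depth of σ t at time t` is at most
`4 · ∑_{t<m} ⌊log₂ (rank of σ t at time t)⌋`, the total access cost on an MRU tree. -/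
theorem movehalf_four_access_competitive_to_mru
    (K : ℕ) (hK : 1 ≤ K) (n : ℕ) (hn : n = 2 ^ K - 1)
    (r0 : Fin n ≃ Fin n) (σ : ℕ → Fin n) (m : ℕ)
    (conf : ℕ → (Fin n ≃ Fin n))
    (hinit : ∀ v : Fin n, sDepth (conf 0 v) = Nat.log 2 (itemRank r0 σ 0 v))
    (hMH : ∀ t, ∃ v : Fin n,
        sDepth (conf t v) = sDepth (conf t (σ t)) / 2 ∧
        (∀ x : Fin n, sDepth (conf t x) = sDepth (conf t (σ t)) / 2 →
          itemRank r0 σ t x ≤ itemRank r0 σ t v) ∧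
        conf (t + 1) = (conf t).trans (Equiv.swap (conf t (σ t)) (conf t v))) :
    ∑ t ∈ Finset.range m, sDepth (conf t (σ t))
      ≤ 4 * ∑ t ∈ Finset.range m, Nat.log 2 (itemRank r0 σ t (σ t)) := by
  have hpotential : ∀ m,
      ∑ x, itemPotential (sDepth (conf m x)) (itemRank r0 σ m x)
          + ∑ t ∈ Finset.range m, sDepth (conf t (σ t))
        ≤ 4 * ∑ t ∈ Finset.range m, Nat.log 2 (itemRank r0 σ t (σ t)) := by
    intro m
    induction m with
    | zero =>
      have h : ∀ x, itemPotential (sDepth (conf 0 x)) (itemRank r0 σ 0 x) = 0 := by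
        intro x
        rw [hinit x]
        simp only [itemPotential, halvingCost]
        split_ifs <;> omega
      simp [h]
    | succ m ih =>
      obtain ⟨v, hv, hmax, hc⟩ := hMH m
      have := sum_itemPotential_succ_add_depth_le r0 σ (conf m) (conf (m + 1)) m v hv hmax hc
      rw [Finset.sum_range_succ, Finset.sum_range_succ]
      omega
  exact (Nat.le_add_left _ _).trans (hpotential m)
end

section
/- The Random-Push algorithm is dynamically optimal in expectation: for every request sequence σ (chosen by an oblivious adversary), the expected total cost (access plus adjustment) of Random-Push on σ is at most 60 times the total cost of an optimal offline algorithm OPT serving σ from the same initial configuration. -/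
/-- The child of server `s` in the complete binary tree: `2s + 1` (left, `b = false`)
or `2s + 2` (right, `b = true`); returns `s` itself if the child index is out of range
(which never happens for servers above the last level of a complete tree). -/
def rpChild {n : ℕ} (s : Fin n) (b : Bool) : Fin n :=
  if h : 2 * s.val + (if b then 2 else 1) < n then
    ⟨2 * s.val + (if b then 2 else 1), h⟩
  else s

/-- The random root-to-bottom path determined by the coin flips `flips`:
it starts at the root and at each server steps to one of its two children
according to the next coin flip. -/
def rpPath {n : ℕ} (hpos : 0 < n) (flips : ℕ → Bool) : ℕ → Fin n
  | 0 => ⟨0, hpos⟩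
  | j + 1 => rpChild (rpPath hpos flips j) (flips j)

/-- One step of the Random-Push (Push-Down Tree) algorithm, serving a request to item
`u` hosted at server `s = c u` at depth `d`: `u` moves to the root, the items on the
random root-to-depth-`d` path determined by `flips` (starting with the former root
item) are shifted down one level along the path, and the item at the end of the path
moves to `s`.  The resulting relocation of items is the cyclic permutation of servers
`root → p 1 → ⋯ → p d → s → root`, given by `List.formPerm` of the path. -/
def rpStep {n : ℕ} (hpos : 0 < n) (flips : ℕ → Bool) (u : Fin n)
    (c : Fin n ≃ Fin n) : Fin n ≃ Fin n :=
  c.trans (List.formPerm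
    (((List.range (sDepth (c u) + 1)).map (rpPath hpos flips)) ++ [c u]))

/-- The (random) configuration of the Random-Push algorithm at each time, starting
from the initial configuration `c0`, serving the request sequence `σ`, with coin
flips `ω t` used when serving the request at time `t`. -/
def rpConf {n : ℕ} (hpos : 0 < n) (c0 : Fin n ≃ Fin n) (σ : ℕ → Fin n)
    (ω : ℕ → ℕ → Bool) : ℕ → Fin n ≃ Fin n
  | 0 => c0
  | t + 1 => rpStep hpos (ω t) (σ t) (rpConf hpos c0 σ ω t)

/-- Extend a finite table of fair coin flips (`m` time steps, at most `K` flips per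
step — enough for a complete tree of `2^K - 1` servers) to a total function. -/
def extendFlips (m K : ℕ) (ω : Fin m → Fin K → Bool) : ℕ → ℕ → Bool :=
  fun t j => if h : t < m ∧ j < K then ω ⟨t, h.1⟩ ⟨j, h.2⟩ else false

section Servers

variable {n : ℕ}

theorem sDepth_root (hpos : 0 < n) : sDepth (⟨0, hpos⟩ : Fin n) = 0 := by
  simp [sDepth]

theorem eq_root_of_sDepth_eq_zero (hpos : 0 < n) {s : Fin n} (h : sDepth s = 0) :
    s = ⟨0, hpos⟩ := by
  have := Nat.lt_pow_succ_log_self (b := 2) (by norm_num) (s.val + 1)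
  unfold sDepth at h
  rw [h] at this
  ext
  simp at this ⊢
  omega

theorem sDepth_lt {K : ℕ} (hn : n + 1 = 2 ^ K) (s : Fin n) : sDepth s < K := by
  refine Nat.log_lt_of_lt_pow (by omega) ?_
  have := s.isLt
  omega

theorem sDepth_sParent (s : Fin n) : sDepth (sParent s) = sDepth s - 1 := by
  unfold sDepth sParent
  rcases Nat.eq_zero_or_pos s.val with h | h
  · simp [h]
  · have h1 : (s.val + 1) / 2 - 1 + 1 = (s.val + 1) / 2 := by omega
    simp only [h1]
    rw [Nat.log_div_base]

/-- At most `2 ^ (k + 1) - 1` servers have depth at most `k`. -/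
theorem card_sDepth_le (k : ℕ) :
    (Finset.univ.filter fun s : Fin n => sDepth s ≤ k).card ≤ 2 ^ (k + 1) - 1 := by
  have : (Finset.univ.filter fun s : Fin n => sDepth s ≤ k).map Fin.valEmbedding
      ⊆ Finset.range (2 ^ (k + 1) - 1) := by
    intro x hx
    simp only [Finset.mem_map, Finset.mem_filter, Finset.mem_univ, true_and] at hx
    obtain ⟨s, hs, rfl⟩ := hx
    have h := Nat.lt_pow_of_log_lt (b := 2) (by norm_num) (Nat.lt_succ_of_le hs)
    simp only [Fin.valEmbedding_apply, Finset.mem_range]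
    simp only [Nat.succ_eq_add_one] at h
    omega
  simpa using Finset.card_le_card this

theorem card_sDepth_apply_le (o : Fin n ≃ Fin n) (k : ℕ) :
    (Finset.univ.filter fun v : Fin n => sDepth (o v) ≤ k).card ≤ 2 ^ (k + 1) - 1 := by
  refine le_trans (Finset.card_le_card_of_injOn o ?_ o.injective.injOn) (card_sDepth_le (n := n) k)
  intro v hv
  simpa using hv

end Servers

section Path

variable {n K : ℕ}

theorem rpChild_val {s : Fin n} (h : 2 * s.val + 2 < n) (b : Bool) :
    (rpChild s b).val = 2 * s.val + (if b then 2 else 1) := by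
  have : 2 * s.val + (if b then 2 else 1) < n := by split_ifs <;> omega
  simp [rpChild, this]

theorem rpPath_bounds (hn : n + 1 = 2 ^ K) (hpos : 0 < n) (f : ℕ → Bool) {j : ℕ} (hj : j < K) :
    2 ^ j ≤ (rpPath hpos f j).val + 1 ∧ (rpPath hpos f j).val + 1 < 2 ^ (j + 1) := by
  induction j with
  | zero => simp [rpPath]
  | succ j ih =>
    obtain ⟨h1, h2⟩ := ih (by omega)
    have h3 : 2 ^ (j + 1 + 1) ≤ 2 ^ K := Nat.pow_le_pow_right (by norm_num) (by omega)
    have e1 := pow_succ 2 (j + 1)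
    have e0 := pow_succ 2 j
    rw [rpPath, rpChild_val (by omega)]
    split_ifs <;> constructor <;> omega

theorem sDepth_rpPath (hn : n + 1 = 2 ^ K) (hpos : 0 < n) (f : ℕ → Bool) {j : ℕ} (hj : j < K) :
    sDepth (rpPath hpos f j) = j := by
  obtain ⟨h1, h2⟩ := rpPath_bounds hn hpos f hj
  exact Nat.log_eq_of_pow_le_of_lt_pow h1 h2

theorem flips_eq_of_rpPath_eq (hn : n + 1 = 2 ^ K) (hpos : 0 < n) {f g : ℕ → Bool} {j : ℕ}
    (hj : j < K) (h : rpPath hpos f j = rpPath hpos g j) : ∀ i < j, f i = g i := by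
  induction j with
  | zero => intro i hi; omega
  | succ j ih =>
    have hb := (rpPath_bounds hn hpos f (show j < K by omega)).2
    have hb' := (rpPath_bounds hn hpos g (show j < K by omega)).2
    have h3 : 2 ^ (j + 1 + 1) ≤ 2 ^ K := Nat.pow_le_pow_right (by norm_num) (by omega)
    have e1 := pow_succ 2 (j + 1)
    have h' := congrArg Fin.val h
    rw [rpPath, rpPath, rpChild_val (by omega), rpChild_val (by omega)] at h'
    have hv : rpPath hpos f j = rpPath hpos g j := by
      ext
      split_ifs at h' <;> omega
    have hfg : f j = g j := by
      rw [hv] at h'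
      cases hf : f j <;> cases hg : g j <;> simp_all
    intro i hi
    rcases Nat.lt_succ_iff_lt_or_eq.mp hi with hi | rfl
    · exact ih (by omega) hv i hi
    · exact hfg

/-- Extend a finite row of coin flips to a total function. -/
def extendRow (a : Fin K → Bool) : ℕ → Bool := fun j => if h : j < K then a ⟨j, h⟩ else false

/-- The random path reaches a given server at depth `j` with probability at most `2⁻ʲ`. -/
theorem card_rpPath_eq_le (hn : n + 1 = 2 ^ K) (hpos : 0 < n) {j : ℕ} (hj : j < K) (s : Fin n) :
    (Finset.univ.filter fun a : Fin K → Bool => rpPath hpos (extendRow a) j = s).card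
      ≤ 2 ^ (K - j) := by
  have hcard : (Finset.univ : Finset (Fin (K - j) → Bool)).card = 2 ^ (K - j) := by simp
  rw [← hcard]
  refine Finset.card_le_card_of_injOn (fun a i => a ⟨j + i.val, by omega⟩) (by simp) ?_
  intro a ha b hb hab
  simp only [Finset.coe_filter, Finset.mem_univ, true_and, Set.mem_ofPred_eq] at ha hb
  have hpre := flips_eq_of_rpPath_eq hn hpos hj (ha.trans hb.symm)
  funext i
  by_cases hi : i.val < j
  · simpa [extendRow] using hpre i hi
  · have := congrFun hab ⟨i.val - j, by omega⟩
    simpa [Nat.add_sub_cancel' (not_lt.mp hi)] using this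

end Path

section Step

variable {n K : ℕ}

theorem rpStep_apply_self (hpos : 0 < n) (f : ℕ → Bool) (u : Fin n) (c : Fin n ≃ Fin n) :
    rpStep hpos f u c u = ⟨0, hpos⟩ := by
  simp only [rpStep, Equiv.trans_apply, List.range_succ_eq_map, List.map_cons, List.cons_append]
  exact List.formPerm_cons_concat_apply_last _ _ _

/-- Serving a request at depth `d` pushes down only the items on the random path strictly above
depth `d`, each by one level. -/
theorem sDepth_rpStep_le (hn : n + 1 = 2 ^ K) (hpos : 0 < n) (f : ℕ → Bool) (u : Fin n)
    (c : Fin n ≃ Fin n) (v : Fin n) :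
    sDepth (rpStep hpos f u c v) ≤ sDepth (c v) +
      (if sDepth (c v) < sDepth (c u) ∧ rpPath hpos f (sDepth (c v)) = c v then 1 else 0) := by
  by_cases hvu : v = u
  · rw [hvu, rpStep_apply_self, sDepth_root]
    exact Nat.zero_le _
  have hcne : c v ≠ c u := fun h => hvu (c.injective h)
  set D := sDepth (c u) with hD
  have hDK : D < K := sDepth_lt hn _
  have hdep : ∀ j, j ≤ D → sDepth (rpPath hpos f j) = j := fun j hj =>
    sDepth_rpPath hn hpos f (by omega)
  have hnod : ((List.range (D + 1)).map (rpPath hpos f)).Nodup := by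
    refine List.Nodup.map_on ?_ List.nodup_range
    intro i hi j hj hij
    simp only [List.mem_range] at hi hj
    have := congrArg sDepth hij
    rwa [hdep i (by omega), hdep j (by omega)] at this
  simp only [rpStep, Equiv.trans_apply, ← hD]
  obtain ⟨L, hL, hLnod, hlen, hget, hmem⟩ : ∃ L : List (Fin n),
      List.formPerm ((List.range (D + 1)).map (rpPath hpos f) ++ [c u]) = L.formPerm ∧
      L.Nodup ∧ D < L.length ∧ (∀ j (h : j < L.length), j ≤ D → L[j] = rpPath hpos f j) ∧
      (∀ x ∈ L, sDepth x ≤ D ∧ ((∃ j ≤ D, x = rpPath hpos f j) ∨ x = c u)) := by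
    have hm : ∀ x ∈ (List.range (D + 1)).map (rpPath hpos f),
        sDepth x ≤ D ∧ ∃ j ≤ D, x = rpPath hpos f j := by
      intro x hx
      simp only [List.mem_map, List.mem_range] at hx
      obtain ⟨j, hj, rfl⟩ := hx
      exact ⟨by rw [hdep j (by omega)]; omega, j, by omega, rfl⟩
    by_cases hend : rpPath hpos f D = c u
    · refine ⟨(List.range (D + 1)).map (rpPath hpos f), ?_, hnod, by simp, by simp,
        fun x hx => ⟨(hm x hx).1, Or.inl (hm x hx).2⟩⟩
      rw [List.range_succ, List.map_append, List.map_singleton, hend, List.append_assoc,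
        List.singleton_append, List.formPerm_append_pair,
        Equiv.swap_self]
      exact mul_one _
    · refine ⟨_, rfl, ?_, by simp, ?_, ?_⟩
      · refine List.Nodup.append hnod (by simp) ?_
        rw [List.disjoint_singleton]
        intro hx
        simp only [List.mem_map, List.mem_range] at hx
        obtain ⟨j, hj, hju⟩ := hx
        have := congrArg sDepth hju
        rw [hdep j (by omega), ← hD] at this
        exact hend (this ▸ hju)
      · intro j h hj
        rw [List.getElem_append_left (by simp; omega)]
        simp
      · intro x hx
        rcases List.mem_append.mp hx with hx | hx
        · exact ⟨(hm x hx).1, Or.inl (hm x hx).2⟩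
        · rw [List.mem_singleton] at hx
          exact ⟨by rw [hx], Or.inr hx⟩
  rw [hL]
  by_cases hv : c v ∈ L
  · have hfm := (hmem _ (List.formPerm_apply_mem_of_mem hv)).1
    rcases (hmem _ hv).2 with ⟨j, hj, hvj⟩ | h
    · have hdv : sDepth (c v) = j := by rw [hvj, hdep j hj]
      rcases hj.lt_or_eq with hj' | rfl
      · rw [hdv, if_pos ⟨hj', hvj.symm⟩]
        rcases Nat.lt_or_ge (j + 1) L.length with hl | hl
        · have h := List.formPerm_apply_lt_getElem L hLnod j hl
          rw [hget j _ hj, hget (j + 1) _ (by omega), ← hvj] at h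
          rw [h, hdep (j + 1) (by omega)]
        · omega
      · omega
    · exact absurd h hcne
  · rw [List.formPerm_apply_of_notMem hv]
    omega

end Step

section Potential

variable {n K : ℕ}

/-- Total excess of the depths in `c` over twice the depths in the reference configuration `o`. -/
def depthExcess (c o : Fin n ≃ Fin n) : ℕ := ∑ v, (sDepth (c v) - 2 * sDepth (o v))

/-- Charge `4` if the configurations have different items at the root. -/
def rootMismatch (hpos : 0 < n) (c o : Fin n ≃ Fin n) : ℕ :=
  if c.symm ⟨0, hpos⟩ = o.symm ⟨0, hpos⟩ then 0 else 4

/-- The potential comparing the configuration `c` of Random-Push with a reference `o`. -/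
def potential (hpos : 0 < n) (c o : Fin n ≃ Fin n) : ℕ :=
  depthExcess c o + rootMismatch hpos c o

theorem potential_self (hpos : 0 < n) (c : Fin n ≃ Fin n) : potential hpos c c = 0 := by
  simp only [potential, rootMismatch, depthExcess, if_true, add_zero]
  exact Finset.sum_eq_zero fun v _ => by omega

theorem rootMismatch_le (hpos : 0 < n) (c o : Fin n ≃ Fin n) : rootMismatch hpos c o ≤ 4 := by
  unfold rootMismatch
  split_ifs <;> omega

theorem depthExcess_swap_le (c o : Fin n ≃ Fin n) (s : Fin n) :
    depthExcess c (o.trans (Equiv.swap s (sParent s))) ≤ depthExcess c o + 2 := by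
  have : ∀ v, sDepth (c v) - 2 * sDepth ((o.trans (Equiv.swap s (sParent s))) v) ≤
      (sDepth (c v) - 2 * sDepth (o v)) + if v = o.symm s then 2 else 0 := by
    intro v
    have hp := sDepth_sParent s
    rw [Equiv.trans_apply]
    by_cases hv : v = o.symm s
    · rw [if_pos hv, hv, Equiv.apply_symm_apply, Equiv.swap_apply_left, hp]
      omega
    · have hs : o v ≠ s := fun h => hv (by rw [← h, Equiv.symm_apply_apply])
      rw [if_neg hv]
      by_cases hq : o v = sParent s
      · rw [hq, Equiv.swap_apply_right, hp]
        omega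
      · rw [Equiv.swap_apply_of_ne_of_ne hs hq]
        omega
  refine (Finset.sum_le_sum fun v _ => this v).trans ?_
  rw [Finset.sum_add_distrib]
  simp [depthExcess]

theorem potential_applySwaps_le (hpos : 0 < n) (c : Fin n ≃ Fin n) (l : List (Fin n))
    (o : Fin n ≃ Fin n) :
    potential hpos c (applySwaps l o) ≤ potential hpos c o + 6 * l.length := by
  induction l generalizing o with
  | nil => simp [applySwaps]
  | cons s l ih =>
    have h1 := ih (o.trans (Equiv.swap s (sParent s)))
    have h2 := depthExcess_swap_le c o s
    have h3 := rootMismatch_le hpos c (o.trans (Equiv.swap s (sParent s)))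
    simp only [applySwaps, List.foldl_cons, List.length_cons, potential] at h1 ⊢
    omega

theorem sum_level_mass_add (k : ℕ) :
    (∑ j ∈ Finset.range (2 * k), 2 ^ (2 * k - j) * (2 ^ (j / 2 + 1) - 1)) + 3 * 2 ^ (k + 1)
      = 4 * 2 ^ (2 * k) + 2 := by
  induction k with
  | zero => simp
  | succ k ih =>
    have hs : ∑ j ∈ Finset.range (2 * k), 2 ^ (2 * (k + 1) - j) * (2 ^ (j / 2 + 1) - 1)
        = 4 * ∑ j ∈ Finset.range (2 * k), 2 ^ (2 * k - j) * (2 ^ (j / 2 + 1) - 1) := by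
      rw [Finset.mul_sum]
      refine Finset.sum_congr rfl fun j hj => ?_
      have := Finset.mem_range.mp hj
      rw [show 2 * (k + 1) - j = (2 * k - j) + 2 by omega, pow_add]
      ring
    rw [show 2 * (k + 1) = 2 * k + 1 + 1 by ring] at hs ⊢
    rw [Finset.sum_range_succ, Finset.sum_range_succ, hs]
    have e1 : 2 * k + 1 + 1 - 2 * k = 2 := by omega
    have e2 : 2 * k + 1 + 1 - (2 * k + 1) = 1 := by omega
    have e3 : 2 * k / 2 = k := by omega
    have e4 : (2 * k + 1) / 2 = k := by omega
    rw [e1, e2, e3, e4]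
    have h1 := pow_succ 2 (2 * k)
    have h2 := pow_succ 2 (2 * k + 1)
    have h3 := pow_succ 2 (k + 1)
    have h4 := Nat.one_le_two_pow (n := k + 1)
    omega

/-- The expected number of misplaced items on the random path is at most `4`. -/
theorem sum_path_mass_le {D : ℕ} (hD : D ≤ K) :
    ∑ j ∈ Finset.range D, 2 ^ (K - j) * (2 ^ (j / 2 + 1) - 1) ≤ 4 * 2 ^ K := by
  have h := sum_level_mass_add K
  have h1 : 2 ^ K * ∑ j ∈ Finset.range D, 2 ^ (K - j) * (2 ^ (j / 2 + 1) - 1)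
      ≤ ∑ j ∈ Finset.range (2 * K), 2 ^ (2 * K - j) * (2 ^ (j / 2 + 1) - 1) := by
    rw [Finset.mul_sum]
    refine le_trans (le_of_eq ?_)
      (Finset.sum_le_sum_of_subset (Finset.range_mono (by omega : D ≤ 2 * K)))
    refine Finset.sum_congr rfl fun j hj => ?_
    have := Finset.mem_range.mp hj
    rw [show 2 * K - j = K + (K - j) by omega, pow_add _ K, mul_assoc]
  have h2 : 2 ≤ 3 * 2 ^ (K + 1) := by
    have := Nat.one_le_two_pow (n := K + 1)
    omega
  have h3 : 2 ^ (2 * K) = 2 ^ K * 2 ^ K := by rw [two_mul, pow_add]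
  refine le_of_mul_le_mul_left ?_ (Nat.two_pow_pos K)
  rw [h3] at h
  linarith

theorem sum_depthExcess_rpStep_le (hn : n + 1 = 2 ^ K) (hpos : 0 < n) (u : Fin n)
    (c o : Fin n ≃ Fin n) :
    ∑ a : Fin K → Bool,
        (depthExcess (rpStep hpos (extendRow a) u c) o + (sDepth (c u) - 2 * sDepth (o u)))
      ≤ 2 ^ K * (depthExcess c o + 4) := by
  set D := sDepth (c u) with hD
  have hDK : D < K := sDepth_lt hn _
  have hpt : ∀ (a : Fin K → Bool) (v : Fin n),
      (sDepth (rpStep hpos (extendRow a) u c v) - 2 * sDepth (o v))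
        + (if v = u then D - 2 * sDepth (o u) else 0)
      ≤ (sDepth (c v) - 2 * sDepth (o v)) + if sDepth (c v) < D ∧ sDepth (o v) ≤ sDepth (c v) / 2 then
          (if rpPath hpos (extendRow a) (sDepth (c v)) = c v then 1 else 0) else 0 := by
    intro a v
    by_cases hvu : v = u
    · subst hvu
      rw [rpStep_apply_self, sDepth_root]
      simp [← hD]
    · have h := sDepth_rpStep_le hn hpos (extendRow a) u c v
      rw [← hD] at h
      rw [if_neg hvu]
      split_ifs at h ⊢ <;> omega
  have hsum : ∀ a : Fin K → Bool,
      depthExcess (rpStep hpos (extendRow a) u c) o + (D - 2 * sDepth (o u))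
      ≤ depthExcess c o + ∑ v, if sDepth (c v) < D ∧ sDepth (o v) ≤ sDepth (c v) / 2 then
          (if rpPath hpos (extendRow a) (sDepth (c v)) = c v then 1 else 0) else 0 := by
    intro a
    have h := Finset.sum_le_sum fun v (_ : v ∈ Finset.univ) => hpt a v
    rw [Finset.sum_add_distrib, Finset.sum_add_distrib] at h
    simpa [depthExcess] using h
  refine (Finset.sum_le_sum fun a _ => hsum a).trans ?_
  rw [Finset.sum_add_distrib, Finset.sum_const, Finset.sum_comm, mul_add]
  refine add_le_add (by simp) ?_
  calc _ ≤ ∑ v, ∑ j ∈ Finset.range D, if sDepth (o v) ≤ j / 2 then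
          (if j = sDepth (c v) then 2 ^ (K - j) else 0) else 0 := by
        refine Finset.sum_le_sum fun v _ => ?_
        by_cases hv : sDepth (c v) < D ∧ sDepth (o v) ≤ sDepth (c v) / 2
        · simp only [if_pos hv]
          rw [← Finset.card_filter]
          refine (card_rpPath_eq_le hn hpos (by omega) (c v)).trans ?_
          refine le_trans ?_ (Finset.single_le_sum (fun _ _ => Nat.zero_le _)
            (Finset.mem_range.mpr hv.1))
          simp [hv.2]
        · simp [if_neg hv]
    _ ≤ ∑ v, ∑ j ∈ Finset.range D, if sDepth (o v) ≤ j / 2 then 2 ^ (K - j) else 0 := by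
        refine Finset.sum_le_sum fun v _ => Finset.sum_le_sum fun j _ => ?_
        split_ifs <;> simp
    _ ≤ ∑ j ∈ Finset.range D, 2 ^ (K - j) * (2 ^ (j / 2 + 1) - 1) := by
        rw [Finset.sum_comm]
        refine Finset.sum_le_sum fun j _ => ?_
        rw [← Finset.sum_filter, Finset.sum_const, smul_eq_mul, mul_comm]
        exact Nat.mul_le_mul_left _ (card_sDepth_apply_le o _)
    _ ≤ 4 * 2 ^ K := sum_path_mass_le hDK.le
    _ = 2 ^ K * 4 := mul_comm _ _

/-- Amortized cost of one request to `u`. -/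
theorem sum_potential_rpStep_le (hn : n + 1 = 2 ^ K) (hpos : 0 < n) (u : Fin n)
    (c o : Fin n ≃ Fin n) :
    ∑ a : Fin K → Bool, (sDepth (c u) + potential hpos (rpStep hpos (extendRow a) u c) o)
      ≤ 2 ^ K * (10 * sDepth (o u) + potential hpos c o) := by
  have hroot : ∀ a : Fin K → Bool,
      (rpStep hpos (extendRow a) u c).symm ⟨0, hpos⟩ = u := fun a => by
    rw [Equiv.symm_apply_eq, rpStep_apply_self]
  by_cases hcu : c u = ⟨0, hpos⟩
  · have hmis : ∀ a : Fin K → Bool,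
        sDepth (c u) + potential hpos (rpStep hpos (extendRow a) u c) o ≤ potential hpos c o := by
      intro a
      have hc : c.symm ⟨0, hpos⟩ = u := by rw [Equiv.symm_apply_eq, hcu]
      have hex : depthExcess (rpStep hpos (extendRow a) u c) o ≤ depthExcess c o := by
        refine Finset.sum_le_sum fun v _ => ?_
        have h := sDepth_rpStep_le hn hpos (extendRow a) u c v
        rw [hcu, sDepth_root] at h
        simp only [Nat.not_lt_zero, false_and, if_false, add_zero] at h
        omega
      rw [hcu, sDepth_root]
      simp only [potential, rootMismatch, hroot, hc]
      omega
    refine (Finset.sum_le_sum fun a _ => hmis a).trans ?_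
    simp only [Finset.sum_const, Finset.card_univ, Fintype.card_fun, Fintype.card_fin,
      Fintype.card_bool, smul_eq_mul]
    exact Nat.mul_le_mul_left _ (by omega)
  · have hmis : ∀ a : Fin K → Bool,
        sDepth (c u) + potential hpos (rpStep hpos (extendRow a) u c) o + 4 ≤
          (depthExcess (rpStep hpos (extendRow a) u c) o + (sDepth (c u) - 2 * sDepth (o u)))
            + (10 * sDepth (o u) + rootMismatch hpos c o) := by
      intro a
      by_cases hou : o u = ⟨0, hpos⟩
      · have ho : o.symm ⟨0, hpos⟩ = u := by rw [Equiv.symm_apply_eq, hou]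
        have hc : c.symm ⟨0, hpos⟩ ≠ u := fun h => hcu (by rw [← h, Equiv.apply_symm_apply])
        simp only [potential, rootMismatch, hroot, ho, hou, sDepth_root, if_true, if_neg hc]
        omega
      · have hpos' : sDepth (o u) ≠ 0 := fun h => hou (eq_root_of_sDepth_eq_zero hpos h)
        have := rootMismatch_le hpos (rpStep hpos (extendRow a) u c) o
        simp only [potential]
        omega
    have h1 := Finset.sum_le_sum fun a (_ : a ∈ Finset.univ) => hmis a
    rw [Finset.sum_add_distrib, Finset.sum_add_distrib (g := fun _ => _ + _)] at h1
    have h2 := sum_depthExcess_rpStep_le hn hpos u c o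
    simp only [Finset.sum_const, Finset.card_univ, Fintype.card_fun, Fintype.card_fin,
      Fintype.card_bool, smul_eq_mul] at h1
    simp only [potential] at h1 ⊢
    nlinarith

theorem rpConf_succ_eq (hpos : 0 < n) (c : Fin n ≃ Fin n) (σ : ℕ → Fin n)
    (ω : ℕ → ℕ → Bool) (t : ℕ) :
    rpConf hpos c σ ω (t + 1) =
      rpConf hpos (rpStep hpos (ω 0) (σ 0) c) (fun i => σ (i + 1)) (fun i => ω (i + 1)) t := by
  induction t with
  | zero => rfl
  | succ t ih => rw [rpConf, ih, rpConf]

theorem extendFlips_cons_zero (m : ℕ) (a : Fin K → Bool) (ω : Fin m → Fin K → Bool) :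
    extendFlips (m + 1) K (Fin.cons a ω) 0 = extendRow a := by
  funext j
  by_cases hj : j < K <;> simp [extendFlips, extendRow, hj]

theorem extendFlips_cons_succ (m : ℕ) (a : Fin K → Bool) (ω : Fin m → Fin K → Bool) (t : ℕ) :
    extendFlips (m + 1) K (Fin.cons a ω) (t + 1) = extendFlips m K ω t := by
  funext j
  by_cases h : t < m ∧ j < K
  · simp only [extendFlips, h, Nat.add_lt_add_iff_right, and_self, dite_true]
    exact congrFun (Fin.cons_succ (α := fun _ => Fin K → Bool) a ω ⟨t, h.1⟩) _
  · simp [extendFlips, h]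

theorem sum_fin_cons {α M : Type*} [Fintype α] [AddCommMonoid M] {m : ℕ}
    (F : (Fin (m + 1) → α) → M) :
    ∑ ω, F ω = ∑ a, ∑ ω : Fin m → α, F (Fin.cons a ω) := by
  rw [← (Fin.consEquiv fun _ : Fin (m + 1) => α).sum_comp, Fintype.sum_prod_type]
  rfl

/-- Summed over all coin flips, the access depths of Random-Push are at most ten times the
offline cost plus the initial potential. -/
theorem total_depth_le (hn : n + 1 = 2 ^ K) (hpos : 0 < n) (m : ℕ) (c : Fin n ≃ Fin n)
    (σ : ℕ → Fin n) (o : ℕ → (Fin n ≃ Fin n)) (l : ℕ → List (Fin n))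
    (hstep : ∀ t, o (t + 1) = applySwaps (l t) (o t)) :
    ∑ ω : Fin m → Fin K → Bool, ∑ t ∈ Finset.range m,
        sDepth (rpConf hpos c σ (extendFlips m K ω) t (σ t))
      ≤ (2 ^ K) ^ m * (10 * ∑ t ∈ Finset.range m, (sDepth (o t (σ t)) + (l t).length)
          + potential hpos c (o 0)) := by
  induction m generalizing c σ o l with
  | zero => simp
  | succ m ih =>
    rw [sum_fin_cons]
    simp only [Finset.sum_range_succ', rpConf_succ_eq,
      extendFlips_cons_zero, extendFlips_cons_succ]
    set T := ∑ t ∈ Finset.range m, (sDepth (o (t + 1) (σ (t + 1))) + (l (t + 1)).length) with hT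
    have hrow : ∀ a : Fin K → Bool,
        ∑ ω : Fin m → Fin K → Bool, (∑ t ∈ Finset.range m,
          sDepth (rpConf hpos (rpStep hpos (extendRow a) (σ 0) c) (fun i => σ (i + 1))
            (fun i => extendFlips m K ω i) t (σ (t + 1))) + sDepth (c (σ 0)))
        ≤ (2 ^ K) ^ m * ((sDepth (c (σ 0))
            + potential hpos (rpStep hpos (extendRow a) (σ 0) c) (o 0))
            + (10 * T + 6 * (l 0).length)) := by
      intro a
      have h := ih (rpStep hpos (extendRow a) (σ 0) c) (fun i => σ (i + 1)) (fun i => o (i + 1))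
        (fun i => l (i + 1)) (fun t => hstep (t + 1))
      have hp := potential_applySwaps_le hpos (rpStep hpos (extendRow a) (σ 0) c) (l 0) (o 0)
      rw [← hstep 0] at hp
      rw [Finset.sum_add_distrib]
      simp only [Finset.sum_const, Finset.card_univ, Fintype.card_fun, Fintype.card_fin,
        Fintype.card_bool, smul_eq_mul]
      refine (Nat.add_le_add_right h _).trans ?_
      rw [← mul_add]
      refine Nat.mul_le_mul_left _ ?_
      simp only [← hT]
      simp only [Nat.zero_add] at hp ⊢
      omega
    refine (Finset.sum_le_sum fun a _ => hrow a).trans ?_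
    rw [← Finset.mul_sum, pow_succ, mul_assoc]
    refine Nat.mul_le_mul_left _ ?_
    rw [Finset.sum_add_distrib]
    have h := sum_potential_rpStep_le hn hpos (σ 0) c (o 0)
    simp only [Finset.sum_const, Finset.card_univ, Fintype.card_fun, Fintype.card_fin,
      Fintype.card_bool, smul_eq_mul]
    refine (Nat.add_le_add_right h _).trans ?_
    rw [← mul_add]
    refine Nat.mul_le_mul_left _ ?_
    omega

end Potential

/-- The Random-Push algorithm is dynamically optimal in expectation: for every request
sequence `σ` of `m` requests (chosen by an oblivious adversary, i.e. independent of
the coin flips), the expected total cost of Random-Push — `5d` per request to an item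
at depth `d` (access `d`, move to root `d`, push-down `d`, moving the last item `2d`) —
is at most `60` times the total cost (access plus one per swap) of any offline
algorithm, in particular of an optimal offline algorithm `OPT`, serving `σ` from the
same initial configuration. -/
theorem randompush_dynamically_optimal_in_expectation
    (K : ℕ) (hK : 1 ≤ K) (n : ℕ) (hn : n = 2 ^ K - 1) (hpos : 0 < n)
    (r0 : Fin n ≃ Fin n) (σ : ℕ → Fin n) (c0 : Fin n ≃ Fin n)
    (hinit : ∀ v : Fin n, sDepth (c0 v) = Nat.log 2 (itemRank r0 σ 0 v))
    (m : ℕ)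
    (optConf : ℕ → (Fin n ≃ Fin n)) (optSwaps : ℕ → List (Fin n))
    (hsame : optConf 0 = c0)
    (hstep : ∀ t, optConf (t + 1) = applySwaps (optSwaps t) (optConf t)) :
    (∑ ω : Fin m → Fin K → Bool, ∑ t ∈ Finset.range m,
          5 * (sDepth (rpConf hpos c0 σ (extendFlips m K ω) t (σ t)) : ℝ))
        / (Fintype.card (Fin m → Fin K → Bool) : ℝ)
      ≤ 60 * ∑ t ∈ Finset.range m,
          ((sDepth (optConf t (σ t)) : ℝ) + ((optSwaps t).length : ℝ)) := by
  have hn' : n + 1 = 2 ^ K := by have := Nat.one_le_two_pow (n := K); omega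
  have h := total_depth_le hn' hpos m c0 σ optConf optSwaps hstep
  rw [hsame, potential_self, add_zero] at h
  have hR : (∑ ω : Fin m → Fin K → Bool, ∑ t ∈ Finset.range m,
      (sDepth (rpConf hpos c0 σ (extendFlips m K ω) t (σ t)) : ℝ))
      ≤ (2 ^ K) ^ m * (10 * ∑ t ∈ Finset.range m,
          ((sDepth (optConf t (σ t)) : ℝ) + ((optSwaps t).length : ℝ))) := by
    exact_mod_cast h
  have hcard : (Fintype.card (Fin m → Fin K → Bool) : ℝ) = (2 ^ K) ^ m := by simp
  have hnonneg : 0 ≤ ∑ t ∈ Finset.range m,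
      ((sDepth (optConf t (σ t)) : ℝ) + ((optSwaps t).length : ℝ)) := by positivity
  have hM : (0 : ℝ) < (2 ^ K) ^ m := by positivity
  rw [hcard, div_le_iff₀ hM]
  simp only [← Finset.mul_sum]
  nlinarith [mul_nonneg hnonneg hM.le]
end
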